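/- Let u₁, u₂ ∈ ℂ with (u₁, u₂) ≠ (0, 0). Then the infimum of |x₁| + |x₂| over all pairs (x₁, x₂) ∈ ℂ × ℂ satisfying x₁·u₁ + x₂·u₂ = u₁ equals |u₁|/max(|u₁|, |u₂|). -/

import Mathlib

/-- Lemme 4.4: the infimum of `|x₁| + |x₂|` over all `(x₁, x₂)` with `x₁*u₁ + x₂*u₂ = u₁`
is `|u₁| / max (|u₁|, |u₂|)`. -/
theorem section_norm_infimum (u₁ u₂ : ℂ) (hu : (u₁, u₂) ≠ (0, 0)) :
    IsGLB {r : ℝ | ∃ x₁ x₂ : ℂ, x₁ * u₁ + x₂ * u₂ = u₁ ∧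
        r = ‖x₁‖ + ‖x₂‖}
      (‖u₁‖ / max ‖u₁‖ ‖u₂‖) := by
  have hpos : 0 < max ‖u₁‖ ‖u₂‖ := by
    by_contra h
    have h1 : ‖u₁‖ ≤ 0 := (le_max_left _ _).trans (not_lt.mp h)
    have h2 : ‖u₂‖ ≤ 0 := (le_max_right _ _).trans (not_lt.mp h)
    exact hu (by rw [norm_le_zero_iff.mp h1, norm_le_zero_iff.mp h2])
  apply IsLeast.isGLB
  constructor
  · rcases le_total ‖u₁‖ ‖u₂‖ with h | h
    · rw [max_eq_right h] at hpos ⊢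
      have h2 : u₂ ≠ 0 := norm_pos_iff.mp hpos
      exact ⟨0, u₁ / u₂, by field_simp; simp, by simp⟩
    · rw [max_eq_left h] at hpos ⊢
      exact ⟨1, 0, by simp, by simp [div_self hpos.ne']⟩
  · rintro r ⟨x₁, x₂, hx, rfl⟩
    rw [div_le_iff₀ hpos]
    calc ‖u₁‖ = ‖x₁ * u₁ + x₂ * u₂‖ := by rw [hx]
      _ ≤ ‖x₁‖ * ‖u₁‖ + ‖x₂‖ * ‖u₂‖ := by
        simpa only [norm_mul] using norm_add_le (x₁ * u₁) (x₂ * u₂)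
      _ ≤ ‖x₁‖ * max ‖u₁‖ ‖u₂‖ + ‖x₂‖ * max ‖u₁‖ ‖u₂‖ := by
        gcongr
        · exact le_max_left _ _
        · exact le_max_right _ _
      _ = (‖x₁‖ + ‖x₂‖) * max ‖u₁‖ ‖u₂‖ := by ring
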